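/- Let K be a field of characteristic 0 and R = K[x1,…,x5]. For T ∈ K let i_T ⊆ R be the ideal generated by F1,…,F17, where F_j = f_j for j ∉ {3,12}, F3 = f3 − T·x4 + T·x2, and F12 = f12 − T·x2x3 − T·x1x3 + T·x2² + T·x1x2, with f1,…,f17 as in the context. Then: (i) for every T ∈ K, the residue classes of the 12 monomials 1, x1, x2, x3, x4, x5, x1², x1x2, x1x3, x2², x2x3, x1³ form a K-basis of R/i_T (in particular dim_K R/i_T = 12); and (ii) for every T ≠ 0, the three points (x1,…,x5) = (0,0,0,T,0), (0,0,0,0,0), (0,−T,0,0,0) of K⁵ are pairwise distinct and every polynomial in i_T vanishes at each of them. -/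

import Mathlib

open MvPolynomial

/-- The generators `F₁,…,F₁₇` of the ideal `i_T` (here `x_i` is `X (i-1)`):
`F_j = f_j` except `F₃ = f₃ − T·x₄ + T·x₂` and
`F₁₂ = f₁₂ − T·x₂x₃ − T·x₁x₃ + T·x₂² + T·x₁x₂`. -/
noncomputable def iTGens (K : Type) [Field K] (T : K) : Set (MvPolynomial (Fin 5) K) :=
  { X 4 ^ 2 + C (4 : K) * X 0 ^ 2 + C ((17 : K) / 3) * (X 0 * X 1)
      - C ((83 : K) / 12) * (X 0 * X 2) - C ((23 : K) / 4) * (X 1 * X 2),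
    X 3 * X 4 - C ((3 : K) / 4) * (X 1 * X 2) - C ((5 : K) / 4) * (X 0 * X 2) + X 0 * X 1,
    X 3 ^ 2 + C ((25 : K) / 6) * (X 1 * X 2) + X 1 ^ 2 + C ((71 : K) / 18) * (X 0 * X 2)
      - C ((28 : K) / 9) * (X 0 * X 1) - C (5 : K) * X 0 ^ 2
      - C T * X 3 + C T * X 1,
    X 2 * X 4 - C ((3 : K) / 4) * (X 1 * X 2) + C ((3 : K) / 4) * (X 0 * X 2) - X 0 * X 1,
    X 2 * X 3 - X 1 * X 2,
    X 2 ^ 2 - C ((85 : K) / 24) * (X 1 * X 2) - C ((317 : K) / 72) * (X 0 * X 2)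
      + C ((71 : K) / 18) * (X 0 * X 1) + C (2 : K) * X 0 ^ 2,
    X 1 * X 4 - C ((3 : K) / 4) * (X 1 * X 2) - C ((5 : K) / 4) * (X 0 * X 2) + X 0 * X 1,
    X 1 * X 3 - X 1 * X 2 - X 0 * X 2 + X 0 * X 1,
    X 0 * X 4 - C ((1 : K) / 4) * (X 1 * X 2) + C ((1 : K) / 4) * (X 0 * X 2) - X 0 * X 1,
    X 0 * X 3 - X 0 * X 1,
    X 1 ^ 2 * X 2 + X 0 ^ 3,
    X 1 ^ 3 + C ((5 : K) / 9) * X 0 ^ 3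
      - C T * (X 1 * X 2) - C T * (X 0 * X 2) + C T * X 1 ^ 2 + C T * (X 0 * X 1),
    X 0 * X 1 * X 2 - C ((11 : K) / 9) * X 0 ^ 3,
    X 0 * X 1 ^ 2 - C ((8 : K) / 9) * X 0 ^ 3,
    X 0 ^ 2 * X 2 + X 0 ^ 3,
    X 0 ^ 2 * X 1 + C ((2 : K) / 3) * X 0 ^ 3,
    X 0 ^ 4 }

/-- The ideal `i_T ⊆ K[x₁,…,x₅]`. -/
noncomputable def iT (K : Type) [Field K] (T : K) : Ideal (MvPolynomial (Fin 5) K) :=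
  Ideal.span (iTGens K T)

/-- The 12 monomials `1, x₁, x₂, x₃, x₄, x₅, x₁², x₁x₂, x₁x₃, x₂², x₂x₃, x₁³`. -/
noncomputable def mons12 (K : Type) [Field K] : Fin 12 → MvPolynomial (Fin 5) K :=
  ![1, X 0, X 1, X 2, X 3, X 4, X 0 ^ 2, X 0 * X 1, X 0 * X 2, X 1 ^ 2, X 1 * X 2, X 0 ^ 3]

/-- Coordinates, with respect to the monomials `mons12`, of multiplication by the variables
modulo `i_T`. -/
def iTMulFun {K : Type} [Field K] (T : K) : Fin 5 → (Fin 12 → K) → Fin 12 → K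
  | 0, v => ![0,
      v 0,
      0,
      0,
      0,
      0,
      v 1,
      v 2 + v 4 + v 5,
      v 3 - 1 / 4 * v 5,
      0,
      1 / 4 * v 5,
      v 6 - 2 / 3 * v 7 - v 8 + 8 / 9 * v 9 + 11 / 9 * v 10]
  | 1, v => ![0,
      0,
      v 0,
      0,
      0,
      0,
      0,
      v 1 - v 4 - v 5 - T * v 9,
      v 4 + 5 / 4 * v 5 + T * v 9,
      v 2 - T * v 9,
      v 3 + v 4 + 3 / 4 * v 5 + T * v 9,
      -2 / 3 * v 6 + 8 / 9 * v 7 + 11 / 9 * v 8 - 5 / 9 * v 9 - v 10]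
  | 2, v => ![0,
      0,
      0,
      v 0,
      0,
      0,
      -2 * v 3,
      -71 / 18 * v 3 + v 5,
      v 1 + 317 / 72 * v 3 - 3 / 4 * v 5,
      0,
      v 2 + 85 / 24 * v 3 + v 4 + 3 / 4 * v 5,
      -v 6 + 11 / 9 * v 7 + 5 / 9 * v 8 - v 9 - 1 / 3 * v 10]
  | 3, v => ![0,
      0,
      -T * v 4,
      0,
      v 0 + T * v 4,
      0,
      5 * v 4,
      v 1 - v 2 + 28 / 9 * v 4 - v 5,
      v 2 - 71 / 18 * v 4 + 5 / 4 * v 5,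
      -v 4,
      v 2 + v 3 - 25 / 6 * v 4 + 3 / 4 * v 5,
      -2 / 3 * v 6 + 8 / 9 * v 7 + 11 / 9 * v 8 - 2 / 3 * v 9 - v 10]
  | 4, v => ![0,
      0,
      0,
      0,
      0,
      v 0,
      -4 * v 5,
      v 1 - v 2 + v 3 - v 4 - 17 / 3 * v 5,
      -1 / 4 * v 1 + 5 / 4 * v 2 - 3 / 4 * v 3 + 5 / 4 * v 4 + 83 / 12 * v 5,
      0,
      1 / 4 * v 1 + 3 / 4 * v 2 + 3 / 4 * v 3 + 3 / 4 * v 4 + 23 / 4 * v 5,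
      -1 / 9 * v 6 + 1 / 3 * v 7 + v 8 - 1 / 9 * v 9 - 7 / 9 * v 10]

/-- Multiplication by the variables modulo `i_T`, as endomorphisms of the coordinate space. -/
def iTMul {K : Type} [Field K] (T : K) (i : Fin 5) : Module.End K (Fin 12 → K) where
  toFun := iTMulFun T i
  map_add' v w := by
    fin_cases i <;>
      simp only [iTMulFun, Pi.add_apply, Matrix.cons_add_cons, Matrix.empty_add_empty,
        Matrix.vecCons_inj] <;>
      refine ⟨?_, ?_, ?_, ?_, ?_, ?_, ?_, ?_, ?_, ?_, ?_, ?_, ?_⟩ <;> first | trivial | ring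
  map_smul' c v := by
    fin_cases i <;>
      simp only [iTMulFun, Pi.smul_apply, Matrix.smul_cons, Matrix.smul_empty, smul_eq_mul,
        RingHom.id_apply, Matrix.vecCons_inj] <;>
      refine ⟨?_, ?_, ?_, ?_, ?_, ?_, ?_, ?_, ?_, ?_, ?_, ?_, ?_⟩ <;> first | trivial | ring

theorem iTMulFun_comm {K : Type} [Field K] [CharZero K] (T : K) (i j : Fin 5) (v : Fin 12 → K) :
    iTMulFun T i (iTMulFun T j v) = iTMulFun T j (iTMulFun T i v) := by
  wlog hij : i < j generalizing i j
  · rcases eq_or_lt_of_not_gt hij with rfl | h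
    · rfl
    · exact (this j i h).symm
  fin_cases i <;> fin_cases j <;> first
    | exact absurd hij (by decide)
    | simp only [iTMulFun, Matrix.cons_val, Matrix.vecCons_inj]
      refine ⟨?_, ?_, ?_, ?_, ?_, ?_, ?_, ?_, ?_, ?_, ?_, ?_, ?_⟩ <;> first | trivial | ring

open scoped IsMulCommutative in
/-- A family of pairwise commuting elements of an algebra, possibly noncommutative, extends to a
homomorphism from the polynomial ring. -/
theorem exists_algHom_of_commute {R A σ : Type*} [CommRing R] [Ring A] [Algebra R A]
    (a : σ → A) (h : ∀ i j, Commute (a i) (a j)) :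
    ∃ φ : MvPolynomial σ R →ₐ[R] A, ∀ i, φ (X i) = a i := by
  have : IsMulCommutative (Algebra.adjoin R (Set.range a)) :=
    Algebra.isMulCommutative_adjoin R <| by
      rintro _ ⟨i, rfl⟩ _ ⟨j, rfl⟩
      exact h i j
  exact ⟨(Algebra.adjoin R (Set.range a)).val.comp
    (aeval fun i => (⟨a i, Algebra.subset_adjoin ⟨i, rfl⟩⟩ : Algebra.adjoin R (Set.range a))),
    fun i => by simp⟩

/-- If an action of the polynomial ring on a module is such that `s` kills `v`, then so does the
ideal generated by `s`. -/
theorem algHom_end_apply_eq_zero_of_mem_span {K V σ : Type*} [Field K] [AddCommGroup V]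
    [Module K V] (φ : MvPolynomial σ K →ₐ[K] Module.End K V) {s : Set (MvPolynomial σ K)} {v : V}
    (hs : ∀ f ∈ s, φ f v = 0) {f : MvPolynomial σ K} (hf : f ∈ Ideal.span s) : φ f v = 0 := by
  induction hf using Submodule.span_induction with
  | mem f hf => exact hs f hf
  | zero => simp
  | add f g _ _ hf hg => simp [hf, hg]
  | smul a f _ hf => simp [hf]

set_option maxHeartbeats 4000000 in
/-- There are linear coordinates on the polynomial ring which vanish on `i_T` and for which the
monomials `mons12` are the standard basis. -/
theorem exists_coordinates {K : Type} [Field K] [CharZero K] (T : K) :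
    ∃ φ : MvPolynomial (Fin 5) K →ₗ[K] (Fin 12 → K),
      (∀ f ∈ iT K T, φ f = 0) ∧ ∀ i, φ (mons12 K i) = Pi.single i 1 := by
  obtain ⟨Φ, hΦ⟩ := exists_algHom_of_commute (R := K) (iTMul T) fun i j =>
    LinearMap.ext fun v => iTMulFun_comm T i j v
  have hX (i : Fin 5) (v : Fin 12 → K) : Φ (X i) v = iTMulFun T i v := by rw [hΦ]; rfl
  have hC (c : K) (v : Fin 12 → K) : Φ (C c) v = c • v := by
    rw [← algebraMap_eq, AlgHom.commutes, Module.algebraMap_end_apply]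
  refine ⟨(LinearMap.applyₗ ![1, 0, 0, 0, 0, 0, 0, 0, 0, 0, 0, 0]).comp Φ.toLinearMap,
    fun f hf => ?_, fun i => ?_⟩
  · refine algHom_end_apply_eq_zero_of_mem_span Φ (fun f hf => ?_) hf
    simp only [iTGens, Set.mem_insert_iff, Set.mem_singleton_iff] at hf
    rcases hf with rfl | rfl | rfl | rfl | rfl | rfl | rfl | rfl | rfl | rfl | rfl | rfl | rfl |
      rfl | rfl | rfl | rfl <;>
      simp only [pow_succ, pow_zero, one_mul, map_add, map_sub, map_mul, hX, hC, iTMulFun,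
        LinearMap.add_apply, LinearMap.sub_apply, Module.End.mul_apply, Matrix.cons_val,
        Matrix.smul_cons, Matrix.smul_empty, Matrix.cons_add_cons, Matrix.empty_add_empty,
        Matrix.cons_sub_cons, Matrix.empty_sub_empty, Matrix.cons_eq_zero_iff, smul_eq_mul] <;>
      refine ⟨?_, ?_, ?_, ?_, ?_, ?_, ?_, ?_, ?_, ?_, ?_, ?_, Subsingleton.elim _ _⟩ <;>
      first | trivial | ring
  · ext k
    fin_cases i <;> fin_cases k <;> simp [mons12, pow_succ, hX, iTMulFun]

/-- Modulo `i_T`, multiplication by the variables acts on combinations of the monomials `mons12`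
through `iTMulFun`. -/
theorem map_X_mul_sum_mons12 {K A : Type} [Field K] [CharZero K] [CommRing A] [Algebra K A]
    {T : K} (π : MvPolynomial (Fin 5) K →ₐ[K] A) (hπ : ∀ f ∈ iTGens K T, π f = 0)
    (i : Fin 5) (v : Fin 12 → K) :
    π (X i) * ∑ j, v j • π (mons12 K j) = ∑ j, iTMulFun T i v j • π (mons12 K j) := by
  obtain ⟨x, hx⟩ : ∃ x : Fin 5 → A, ∀ i, π (X i) = x i := ⟨_, fun _ => rfl⟩
  have hC (c : K) : π (C c) = algebraMap K A c := π.commutes c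
  simp only [iTGens, Set.mem_insert_iff, Set.mem_singleton_iff, forall_eq_or_imp, forall_eq,
    map_add, map_sub, map_mul, map_pow, hC, hx] at hπ
  obtain ⟨h1, h2, h3, h4, h5, h6, h7, h8, h9, h10, h11, h12, h13, h14, h15, h16, h17⟩ := hπ
  fin_cases i <;>
    simp [Fin.sum_univ_succ, mons12, iTMulFun, hx, Algebra.smul_def]
  · linear_combination (norm := algebra)
      algebraMap K A (v 4) * h10 +
      algebraMap K A (v 5) * h9 +
      algebraMap K A (v 7) * h16 +
      algebraMap K A (v 8) * h15 +
      algebraMap K A (v 9) * h14 +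
      algebraMap K A (v 10) * h13 +
      algebraMap K A (v 11) * h17
  · linear_combination (norm := algebra)
      algebraMap K A (v 4) * h8 +
      algebraMap K A (v 5) * h7 +
      algebraMap K A (v 6) * h16 +
      algebraMap K A (v 7) * h14 +
      algebraMap K A (v 8) * h13 +
      algebraMap K A (v 9) * h12 +
      algebraMap K A (v 10) * h11 +
      algebraMap K A (v 11) * (x 0 * h16 - algebraMap K A (2 / 3) * h17)
  · linear_combination (norm := algebra)
      algebraMap K A (v 3) * h6 +
      algebraMap K A (v 4) * h5 +
      algebraMap K A (v 5) * h4 +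
      algebraMap K A (v 6) * h15 +
      algebraMap K A (v 7) * h13 +
      algebraMap K A (v 8) * (x 0 * h6 + algebraMap K A (85 / 24) * h13 +
        algebraMap K A (317 / 72) * h15 - algebraMap K A (71 / 18) * h16) +
      algebraMap K A (v 9) * h11 +
      algebraMap K A (v 10) * (x 1 * h6 + algebraMap K A (85 / 24) * h11 +
        algebraMap K A (317 / 72) * h13 - algebraMap K A (71 / 18) * h14 -
        algebraMap K A 2 * h16) +
      algebraMap K A (v 11) * (x 0 * h15 - h17)
  · linear_combination (norm := algebra)
      algebraMap K A (v 1) * h10 +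
      algebraMap K A (v 2) * h8 +
      algebraMap K A (v 3) * h5 +
      algebraMap K A (v 4) * h3 +
      algebraMap K A (v 5) * h2 +
      algebraMap K A (v 6) * (x 0 * h10 + h16) +
      algebraMap K A (v 7) * (x 0 * h8 + h13 + h15 - h16) +
      algebraMap K A (v 8) * (x 0 * h5 + h13) +
      algebraMap K A (v 9) * (x 1 * h8 + h11 + h13 - h14) +
      algebraMap K A (v 10) * (x 1 * h5 + h11) +
      algebraMap K A (v 11) * (x 0 ^ 2 * h10 + x 0 * h16 - algebraMap K A (2 / 3) * h17)
  · linear_combination (norm := algebra)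
      algebraMap K A (v 1) * h9 +
      algebraMap K A (v 2) * h7 +
      algebraMap K A (v 3) * h4 +
      algebraMap K A (v 4) * h2 +
      algebraMap K A (v 5) * h1 +
      algebraMap K A (v 6) * (x 0 * h9 + algebraMap K A (1 / 4) * h13 -
        algebraMap K A (1 / 4) * h15 + h16) +
      algebraMap K A (v 7) * (x 0 * h7 + algebraMap K A (3 / 4) * h13 +
        algebraMap K A (5 / 4) * h15 - h16) +
      algebraMap K A (v 8) * (x 0 * h4 + algebraMap K A (3 / 4) * h13 -
        algebraMap K A (3 / 4) * h15 + h16) +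
      algebraMap K A (v 9) * (x 1 * h7 + algebraMap K A (3 / 4) * h11 +
        algebraMap K A (5 / 4) * h13 - h14) +
      algebraMap K A (v 10) * (x 1 * h4 + algebraMap K A (3 / 4) * h11 -
        algebraMap K A (3 / 4) * h13 + h14) +
      algebraMap K A (v 11) * (x 0 ^ 2 * h9 + algebraMap K A (1 / 4) * x 0 * h13 -
        algebraMap K A (1 / 4) * x 0 * h15 + x 0 * h16 - algebraMap K A (1 / 9) * h17)

theorem span_map_mons12 {K A : Type} [Field K] [CharZero K] [CommRing A] [Algebra K A]
    {T : K} (π : MvPolynomial (Fin 5) K →ₐ[K] A) (hπ : ∀ f ∈ iTGens K T, π f = 0)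
    (hs : Function.Surjective π) :
    Submodule.span K (Set.range fun i => π (mons12 K i)) = ⊤ := by
  rw [← Fintype.range_linearCombination, LinearMap.range_eq_top]
  intro a
  obtain ⟨f, rfl⟩ := hs a
  induction f using MvPolynomial.induction_on with
  | C c =>
    refine ⟨Pi.single 0 c, ?_⟩
    rw [Fintype.linearCombination_apply_single, ← algebraMap_eq, AlgHom.commutes]
    simp [mons12, Algebra.algebraMap_eq_smul_one]
  | add f g hf hg =>
    obtain ⟨v, hv⟩ := hf
    obtain ⟨w, hw⟩ := hg
    exact ⟨v + w, by rw [map_add, map_add, hv, hw]⟩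
  | mul_X f i hf =>
    obtain ⟨v, hv⟩ := hf
    refine ⟨iTMulFun T i v, ?_⟩
    rw [map_mul, ← hv, mul_comm]
    simp only [Fintype.linearCombination_apply]
    exact (map_X_mul_sum_mons12 π hπ i v).symm

theorem linearIndependent_mk_mons12 {K : Type} [Field K] [CharZero K] (T : K) :
    LinearIndependent K (fun i => Ideal.Quotient.mk (iT K T) (mons12 K i)) := by
  obtain ⟨φ, hφ, hm⟩ := exists_coordinates T
  rw [Fintype.linearIndependent_iff]
  intro g hg i
  have h : ∑ i, g i • mons12 K i ∈ iT K T := by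
    rw [← Ideal.Quotient.eq_zero_iff_mem, ← hg, map_sum]
    rfl
  have := congrFun (hφ _ h) i
  simpa [hm, Pi.single_apply] using this

theorem eval_eq_zero_of_mem_iT {K : Type} [Field K] {T : K} {p : Fin 5 → K}
    (hp : ∀ f ∈ iTGens K T, eval p f = 0) (f : MvPolynomial (Fin 5) K) (hf : f ∈ iT K T) :
    eval p f = 0 :=
  (Ideal.span_le (I := RingHom.ker (eval p))).2 hp hf

theorem iT_basis_and_points (K : Type) [Field K] [CharZero K] :
    -- (i) for every `T`, the 12 monomials give a `K`-basis of `R/i_T`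
    (∀ T : K,
      LinearIndependent K (fun i => Ideal.Quotient.mk (iT K T) (mons12 K i)) ∧
      Submodule.span K (Set.range (fun i => Ideal.Quotient.mk (iT K T) (mons12 K i))) = ⊤ ∧
      Module.finrank K (MvPolynomial (Fin 5) K ⧸ iT K T) = 12) ∧
    -- (ii) for `T ≠ 0`, the three points are pairwise distinct zeros of `i_T`
    (∀ T : K, T ≠ 0 →
      (![0, 0, 0, T, 0] : Fin 5 → K) ≠ ![0, 0, 0, 0, 0] ∧
      (![0, 0, 0, T, 0] : Fin 5 → K) ≠ ![0, -T, 0, 0, 0] ∧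
      (![0, 0, 0, 0, 0] : Fin 5 → K) ≠ ![0, -T, 0, 0, 0] ∧
      (∀ f ∈ iT K T, eval (![0, 0, 0, T, 0] : Fin 5 → K) f = 0) ∧
      (∀ f ∈ iT K T, eval (![0, 0, 0, 0, 0] : Fin 5 → K) f = 0) ∧
      (∀ f ∈ iT K T, eval (![0, -T, 0, 0, 0] : Fin 5 → K) f = 0)) := by
  refine ⟨fun T => ?_, fun T hT => ⟨?_, ?_, ?_, ?_, ?_, ?_⟩⟩
  · have hli := linearIndependent_mk_mons12 T
    have hsp : Submodule.span K (Set.range fun i => Ideal.Quotient.mk (iT K T) (mons12 K i)) = ⊤ :=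
      span_map_mons12 (Ideal.Quotient.mkₐ K (iT K T))
        (fun f hf => Ideal.Quotient.eq_zero_iff_mem.2 (Ideal.subset_span hf))
        (Ideal.Quotient.mkₐ_surjective K _)
    refine ⟨hli, hsp, ?_⟩
    rw [Module.finrank_eq_card_basis (Module.Basis.mk hli hsp.ge), Fintype.card_fin]
  · exact fun h => hT (by simpa using congrFun h 3)
  · exact fun h => hT (by simpa using congrFun h 3)
  · exact fun h => hT (by simpa using congrFun h 1)
  all_goals
    refine eval_eq_zero_of_mem_iT ?_
    simp [iTGens, pow_succ, mul_assoc]
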